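/- Suppose γ > 0, α > −1, and 0 < p < ∞. For a holomorphic function f on 𝔹_n, define the maximal function M_γ f(z) = sup_{w ∈ D(z,γ)} |f(w)|. Then f ∈ A^p_α if and only if M_γ f ∈ L^p(𝔹_n, dv_α); moreover there is a constant C > 0, depending only on γ, α, p, n, such that C^{-1} ‖M_γ f‖_{L^p(dv_α)} ≤ ‖f‖_{p,α} ≤ C ‖M_γ f‖_{L^p(dv_α)} for all holomorphic f on 𝔹_n. -/

import Mathlib

open MeasureTheory Filter Topology
open scoped Classical ENNReal

noncomputable section

/-- `ℂⁿ` with the Euclidean norm. -/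
abbrev En (n : ℕ) := EuclideanSpace ℂ (Fin n)

instance (n : ℕ) : MeasurableSpace (En n) := borel _
instance (n : ℕ) : BorelSpace (En n) := ⟨rfl⟩

/-- The Lebesgue volume measure on `ℂⁿ`. -/
def vol (n : ℕ) : Measure (En n) := Measure.addHaar

/-- The open unit ball `𝔹ₙ` of `ℂⁿ`. -/
def uball (n : ℕ) : Set (En n) := Metric.ball 0 1

/-- The Hermitian pairing `⟨z,w⟩ = ∑ⱼ zⱼ * conj wⱼ`. -/
def herm {n : ℕ} (z w : En n) : ℂ := ∑ j, z j * (starRingEnd ℂ) (w j)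

/-- The orthogonal projection `P_z w` onto the line spanned by `z`. -/
def prj {n : ℕ} (z w : En n) : En n :=
  if z = 0 then 0 else (herm w z / herm z z) • z

/-- The Möbius automorphism `φ_z` of the unit ball. -/
def mobius {n : ℕ} (z w : En n) : En n :=
  ((1 : ℂ) / (1 - herm w z)) •
    (z - prj z w - ((Real.sqrt (1 - ‖z‖ ^ 2) : ℝ) : ℂ) • (w - prj z w))

/-- The Bergman metric `β(z,w)`. -/
def bmet {n : ℕ} (z w : En n) : ℝ :=
  (1 / 2) * Real.log ((1 + ‖mobius z w‖) / (1 - ‖mobius z w‖))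

/-- The Bergman metric ball `D(z,γ)`. -/
def Dball {n : ℕ} (z : En n) (γ : ℝ) : Set (En n) :=
  {w | w ∈ uball n ∧ bmet z w < γ}

/-- The normalizing constant `c_α`. -/
def cnorm (n : ℕ) (α : ℝ) : ℝ :=
  if -1 < α then Real.Gamma (n + α + 1) / (n.factorial * Real.Gamma (α + 1)) else 1

/-- The weighted measure `dv_α = c_α (1-|z|²)^α dv` on the unit ball. -/
def measA (n : ℕ) (α : ℝ) : Measure (En n) :=
  ((vol n).restrict (uball n)).withDensity
    (fun z => ENNReal.ofReal (cnorm n α * (1 - ‖z‖ ^ 2) ^ α))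

/-- The invariant measure `dτ = (1-|z|²)^{-(n+1)} dv` on the unit ball. -/
def measTau (n : ℕ) : Measure (En n) :=
  ((vol n).restrict (uball n)).withDensity
    (fun z => ENNReal.ofReal ((1 - ‖z‖ ^ 2) ^ (-((n : ℝ) + 1))))

/-- The Bergman space (quasi-)norm `‖f‖_{p,α}`, valued in `ℝ≥0∞`. -/
def apnorm (n : ℕ) (p α : ℝ) (f : En n → ℂ) : ℝ≥0∞ :=
  (∫⁻ z, ENNReal.ofReal (‖f z‖ ^ p) ∂measA n α) ^ (1 / p)

/-- The radial derivative `Rf(z) = ∑ z_k ∂f/∂z_k = Df(z)[z]`. -/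
def radD {n : ℕ} (f : En n → ℂ) (z : En n) : ℂ := fderiv ℂ f z z

/-- Iterated radial derivative `R^k f`. -/
def radIter {n : ℕ} : ℕ → (En n → ℂ) → En n → ℂ
  | 0, f => f
  | (k + 1), f => radD (radIter k f)

/-- The pseudo-metric `ϱ` on the unit ball. -/
def rho {n : ℕ} (z w : En n) : ℝ :=
  if z ≠ 0 ∧ w ≠ 0 then
    |‖z‖ - ‖w‖| + ‖1 - herm z w / ((‖z‖ : ℂ) * (‖w‖ : ℂ))‖
  else ‖z‖ + ‖w‖

/-- The Bergman-ball maximal function `M_γ g(z) = sup_{w ∈ D(z,γ)} g(w)`, valued in `ℝ≥0∞`. -/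
def maxF {n : ℕ} (γ : ℝ) (g : En n → ℝ) (z : En n) : ℝ≥0∞ :=
  ⨆ w ∈ Dball z γ, ENNReal.ofReal (g w)


lemma aux_log (g : ℂ → ℂ) (hg : AnalyticOnNhd ℂ g (Metric.closedBall 0 1)) (h0 : g 0 ≠ 0) :
    Real.log ‖g 0‖ ≤ Real.circleAverage (fun z => Real.log ‖g z‖) 0 1 := by
  have hg' : AnalyticOnNhd ℂ g (Metric.closedBall 0 |1|) := by simpa using hg
  rw [AnalyticOnNhd.circleAverage_log_norm one_ne_zero hg' h0]
  have : 0 ≤ ∑ᶠ u, (MeromorphicOn.divisor g (Metric.closedBall 0 |1|) u : ℝ)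
      * Real.log (1 * ‖0 - u‖⁻¹) := by
    apply finsum_nonneg
    intro u
    by_cases hu : u ∈ Metric.closedBall (0 : ℂ) |1|
    · apply mul_nonneg
      · exact_mod_cast MeromorphicOn.AnalyticOnNhd.divisor_nonneg hg' u
      · by_cases hu0 : u = 0
        · simp [hu0]
        · apply Real.log_nonneg
          rw [one_mul, zero_sub, norm_neg]
          apply (one_le_inv₀ (norm_pos_iff.2 hu0)).2
          simpa using hu
    · rw [Function.locallyFinsuppWithin.apply_eq_zero_of_notMem _ hu]
      simp
  linarith

lemma aux_pow (g : ℂ → ℂ) (hg : AnalyticOnNhd ℂ g (Metric.closedBall 0 1)) (p : ℝ) (hp : 0 < p) :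
    ‖g 0‖ ^ p ≤ Real.circleAverage (fun z => ‖g z‖ ^ p) 0 1 := by
  have hcont : CircleIntegrable (fun z => ‖g z‖ ^ p) 0 1 := by
    apply ContinuousOn.circleIntegrable zero_le_one
    apply ContinuousOn.rpow_const
    · exact (hg.continuousOn.mono Metric.sphere_subset_closedBall).norm
    · intro x hx; right; exact hp.le
  by_cases h0 : g 0 = 0
  · rw [h0, norm_zero, Real.zero_rpow hp.ne']
    rw [← Real.circleAverage_const (0 : ℝ) 0 1]
    apply Real.circleAverage_mono (circleIntegrable_const _ _ _) hcont
    intro x hx; positivity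
  have hn : 0 < ‖g 0‖ := norm_pos_iff.2 h0
  set A := ‖g 0‖ ^ p with hA
  have hA0 : 0 < A := Real.rpow_pos_of_pos hn p
  let h : ℂ → ℝ := fun z => if g z = 0 then A * (1 - p * Real.log ‖g 0‖) else ‖g z‖ ^ p
  have hco : (fun z => ‖g z‖ ^ p) =ᶠ[codiscreteWithin (Metric.sphere (0:ℂ) |1|)] h := by
    have := AnalyticOnNhd.preimage_zero_mem_codiscreteWithin hg h0 (by simp)
      ⟨⟨0, by simp⟩, (convex_closedBall (0:ℂ) 1).isPreconnected⟩
    apply Filter.codiscreteWithin_mono (U := Metric.closedBall 0 1)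
      (by simpa using Metric.sphere_subset_closedBall)
    filter_upwards [this] with z hz
    have : g z ≠ 0 := by simpa using hz
    simp [h, this]
  have hlogint : CircleIntegrable (fun z => Real.log ‖g z‖) 0 1 := by
    apply MeromorphicOn.circleIntegrable_log_norm
    exact (hg.mono (by simpa using Metric.sphere_subset_closedBall)).meromorphicOn
  rw [Real.circleAverage_congr_codiscreteWithin hco one_ne_zero]
  have hle : Real.circleAverage (fun z => A * (1 - p * Real.log ‖g 0‖) + (A * p) • Real.log ‖g z‖) 0 1
      ≤ Real.circleAverage h 0 1 := by
    apply Real.circleAverage_mono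
    · exact (circleIntegrable_const _ _ _).add (IntervalIntegrable.const_mul hlogint _)
    · exact CircleIntegrable.congr_codiscreteWithin hco hcont
    · intro z hz
      by_cases hz0 : g z = 0
      · simp [h, hz0]
      · simp only [h, hz0, if_false, smul_eq_mul]
        have hzn : 0 < ‖g z‖ := norm_pos_iff.2 hz0
        have e1 : ‖g z‖ ^ p = A * Real.exp (p * (Real.log ‖g z‖ - Real.log ‖g 0‖)) := by
          rw [hA, Real.rpow_def_of_pos hzn, Real.rpow_def_of_pos hn, ← Real.exp_add]
          congr 1; ring
        rw [e1]
        have := Real.add_one_le_exp (p * (Real.log ‖g z‖ - Real.log ‖g 0‖))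
        nlinarith
  refine le_trans ?_ hle
  have hl2 : CircleIntegrable (fun z => (A * p) • Real.log ‖g z‖) 0 1 :=
    IntervalIntegrable.const_mul hlogint _
  rw [Real.circleAverage_fun_add (circleIntegrable_const _ _ _) hl2,
    Real.circleAverage_const, Real.circleAverage_fun_smul, smul_eq_mul]
  have := aux_log g hg h0
  have h2 : 0 < A * p := by positivity
  nlinarith [mul_le_mul_of_nonneg_left this h2.le]

lemma aux_lint (g : ℂ → ℂ) (hg : AnalyticOnNhd ℂ g (Metric.closedBall 0 1)) (p : ℝ) (hp : 0 < p) :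
    ENNReal.ofReal (2 * Real.pi) * ENNReal.ofReal (‖g 0‖ ^ p) ≤
      ∫⁻ θ in Set.Ioc 0 (2 * Real.pi), ENNReal.ofReal (‖g (circleMap 0 1 θ)‖ ^ p) := by
  have hcont : CircleIntegrable (fun z => ‖g z‖ ^ p) 0 1 := by
    apply ContinuousOn.circleIntegrable zero_le_one
    apply ContinuousOn.rpow_const
    · exact (hg.continuousOn.mono Metric.sphere_subset_closedBall).norm
    · intro x hx; right; exact hp.le
  have h := aux_pow g hg p hp
  have hpi : 0 < 2 * Real.pi := by positivity
  rw [Real.circleAverage_def, smul_eq_mul, inv_mul_eq_div, le_div_iff₀ hpi,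
    intervalIntegral.integral_of_le hpi.le] at h
  rw [← ENNReal.ofReal_mul hpi.le, ← ofReal_integral_eq_lintegral_ofReal]
  · apply ENNReal.ofReal_le_ofReal; linarith
  · have := hcont; unfold CircleIntegrable at this
    rwa [intervalIntegrable_iff_integrableOn_Ioc_of_le hpi.le] at this
  · exact Eventually.of_forall fun _ => by positivity

lemma aux_rot {E : Type*} [NormedAddCommGroup E] [NormedSpace ℂ E] [FiniteDimensional ℂ E]
    [MeasurableSpace E] [BorelSpace E] (μ : Measure E) [μ.IsAddHaarMeasure] (c : ℂ) (hc : ‖c‖ = 1) :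
    MeasurePreserving (fun u : E => c • u) μ μ := by
  have hc0 : c ≠ 0 := by intro h; simp [h] at hc
  have : FiniteDimensional ℝ E := FiniteDimensional.complexToReal E
  have : ProperSpace E := FiniteDimensional.proper ℂ E
  let L : E ≃L[ℂ] E := ContinuousLinearEquiv.smulLeft (Units.mk0 c hc0)
  have hL : (fun u : E => c • u) = L := by
    ext u; rfl
  refine ⟨by fun_prop, ?_⟩
  rw [hL]
  have hh : (μ.map L).IsAddHaarMeasure := L.isAddHaarMeasure_map μ
  have h1 := Measure.isAddLeftInvariant_eq_smul (μ.map L) μ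
  have hb : L ⁻¹' (Metric.ball 0 1) = Metric.ball 0 1 := by
    ext u
    rw [← hL]
    simp [norm_smul, hc]
  have h2 : (μ.map L) (Metric.ball 0 1) = μ (Metric.ball 0 1) := by
    rw [Measure.map_apply L.continuous.measurable measurableSet_ball, hb]
  rw [h1] at h2
  have hpos : μ (Metric.ball (0:E) 1) ≠ 0 := (Metric.measure_ball_pos μ _ one_pos).ne'
  have hfin : μ (Metric.ball (0:E) 1) ≠ ⊤ := measure_ball_lt_top.ne
  rw [h1]
  have h3 : (((μ.map L).addHaarScalarFactor μ : NNReal) : ℝ≥0∞) = 1 := by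
    have : (((μ.map L).addHaarScalarFactor μ : NNReal) : ℝ≥0∞) * μ (Metric.ball (0:E) 1)
      = 1 * μ (Metric.ball (0:E) 1) := by
      rw [one_mul]; exact h2
    exact (ENNReal.mul_left_inj hpos hfin).1 this
  have h4 : (μ.map L).addHaarScalarFactor μ = 1 := by exact_mod_cast h3
  rw [h4, one_smul]

lemma aux_submean {E : Type*} [NormedAddCommGroup E] [NormedSpace ℂ E] [FiniteDimensional ℂ E]
    [MeasurableSpace E] [BorelSpace E] (μ : Measure E) [μ.IsAddHaarMeasure]
    (f : E → ℂ) (U : Set E) (hU : IsOpen U) (hf : DifferentiableOn ℂ f U) (p : ℝ) (hp : 0 < p)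
    (G : E → ℝ≥0∞) (hGm : Measurable G) (hG : ∀ z ∈ U, G z = ENNReal.ofReal (‖f z‖ ^ p))
    (w : E) (S : Set E) (hS : MeasurableSet S)
    (hbal : ∀ c : ℂ, ‖c‖ ≤ 1 → ∀ u ∈ S, c • u ∈ S) (hSU : ∀ u ∈ S, w + u ∈ U) :
    ENNReal.ofReal (‖f w‖ ^ p) * μ S ≤ ∫⁻ u in S, G (w + u) ∂μ := by
  have : ProperSpace E := FiniteDimensional.proper ℂ E
  have key : ∀ u ∈ S, ENNReal.ofReal (2 * Real.pi) * ENNReal.ofReal (‖f w‖ ^ p) ≤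
      ∫⁻ θ in Set.Ioc 0 (2 * Real.pi), G (w + circleMap 0 1 θ • u) := by
    intro u hu
    let g : ℂ → ℂ := fun c => f (w + c • u)
    have hg : AnalyticOnNhd ℂ g (Metric.closedBall 0 1) := by
      have hV : IsOpen ((fun c : ℂ => w + c • u) ⁻¹' U) := hU.preimage (by fun_prop)
      have hd : DifferentiableOn ℂ g ((fun c : ℂ => w + c • u) ⁻¹' U) := by
        apply hf.comp (by fun_prop)
        intro c hc; exact hc
      refine (hd.analyticOnNhd hV).mono ?_
      intro c hc
      exact hSU _ (hbal c (by simpa using hc) u hu)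
    have := aux_lint g hg p hp
    refine le_trans (by simp [g]) (this.trans (le_of_eq ?_))
    apply lintegral_congr
    intro θ
    rw [hG _ (hSU _ (hbal _ (by simp) u hu))]
  have hrot : ∀ θ : ℝ, ∫⁻ u in S, G (w + circleMap 0 1 θ • u) ∂μ = ∫⁻ u in S, G (w + u) ∂μ := by
    intro θ
    have hc : ‖circleMap 0 1 θ‖ = 1 := by simp
    have hc0 : circleMap 0 1 θ ≠ 0 := by intro h; simp [h] at hc
    rw [← lintegral_indicator hS, ← lintegral_indicator hS,
      ← (aux_rot μ _ hc).lintegral_comp (f := S.indicator fun u => G (w + u))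
      ((hGm.comp (by fun_prop)).indicator hS)]
    apply lintegral_congr
    intro u
    have hiff : circleMap 0 1 θ • u ∈ S ↔ u ∈ S := by
      refine ⟨fun h => ?_, fun h => hbal _ hc.le _ h⟩
      have := hbal (circleMap 0 1 θ)⁻¹ (by simp) _ h
      rwa [smul_smul, inv_mul_cancel₀ hc0, one_smul] at this
    by_cases hu : u ∈ S
    · rw [Set.indicator_of_mem hu, Set.indicator_of_mem (hiff.2 hu)]
    · rw [Set.indicator_of_notMem hu, Set.indicator_of_notMem (fun h => hu (hiff.1 h))]
  have hpi : 0 < 2 * Real.pi := by positivity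
  have h1 : ENNReal.ofReal (2 * Real.pi) * (ENNReal.ofReal (‖f w‖ ^ p) * μ S) ≤
      ENNReal.ofReal (2 * Real.pi) * ∫⁻ u in S, G (w + u) ∂μ := by
    calc ENNReal.ofReal (2 * Real.pi) * (ENNReal.ofReal (‖f w‖ ^ p) * μ S)
        = ∫⁻ u in S, ENNReal.ofReal (2 * Real.pi) * ENNReal.ofReal (‖f w‖ ^ p) ∂μ := by
          rw [setLIntegral_const, mul_assoc]
      _ ≤ ∫⁻ u in S, (∫⁻ θ in Set.Ioc 0 (2 * Real.pi), G (w + circleMap 0 1 θ • u)) ∂μ :=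
          setLIntegral_mono' hS key
      _ = ∫⁻ θ in Set.Ioc 0 (2 * Real.pi), (∫⁻ u in S, G (w + circleMap 0 1 θ • u) ∂μ) := by
          apply lintegral_lintegral_swap
          apply Measurable.aemeasurable
          apply hGm.comp
          apply Continuous.measurable
          fun_prop
      _ = ENNReal.ofReal (2 * Real.pi) * ∫⁻ u in S, G (w + u) ∂μ := by
          simp_rw [hrot]
          rw [setLIntegral_const, Real.volume_Ioc, sub_zero, mul_comm]
  exact (ENNReal.mul_le_mul_iff_right (by simpa using hpi) ENNReal.ofReal_ne_top).1 h1

section geom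
variable {E : Type*} [NormedAddCommGroup E] [InnerProductSpace ℂ E]

/-- The nearness relation. -/
def Nr (K : ℝ) (z w : E) : Prop :=
  ‖1 - inner ℂ z w‖ ≤ K * (1 - ‖z‖ ^ 2) ∧ ‖1 - inner ℂ z w‖ ≤ K * (1 - ‖w‖ ^ 2)

lemma one_sub_symm (z w : E) : ‖(1:ℂ) - inner ℂ z w‖ = ‖(1:ℂ) - inner ℂ w z‖ := by
  rw [← inner_conj_symm z w, ← RCLike.norm_conj]
  simp

lemma Nr.symm {K : ℝ} {z w : E} (h : Nr K z w) : Nr K w z := by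
  unfold Nr at *
  rw [one_sub_symm w z]
  exact ⟨h.2, h.1⟩

lemma dl_pos {z : E} (hz : ‖z‖ < 1) : 0 < 1 - ‖z‖ ^ 2 := by
  nlinarith [norm_nonneg z]

lemma Nr.mono {K L : ℝ} {z w : E} (hz : ‖z‖ < 1) (hw : ‖w‖ < 1) (hKL : K ≤ L) (h : Nr K z w) :
    Nr L z w := by
  have h1 := dl_pos hz
  have h2 := dl_pos hw
  exact ⟨h.1.trans (by gcongr), h.2.trans (by gcongr)⟩

lemma dl_le (z w : E) (hz : ‖z‖ < 1) (hw : ‖w‖ < 1) :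
    1 - ‖w‖ ^ 2 ≤ 2 * ‖(1:ℂ) - inner ℂ z w‖ := by
  have h1 : ‖inner ℂ z w‖ ≤ ‖z‖ * ‖w‖ := norm_inner_le_norm z w
  have h2 : ‖(1:ℂ)‖ - ‖inner ℂ z w‖ ≤ ‖(1:ℂ) - inner ℂ z w‖ := norm_sub_norm_le _ _
  rw [norm_one] at h2
  nlinarith [norm_nonneg z, norm_nonneg w]

lemma Nr.dl_le {K : ℝ} {z w : E} (hz : ‖z‖ < 1) (hw : ‖w‖ < 1) (h : Nr K z w) :
    1 - ‖w‖ ^ 2 ≤ 2 * K * (1 - ‖z‖ ^ 2) := by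
  have := _root_.dl_le z w hz hw
  have := h.1
  linarith

lemma sub_sq_le (z w : E) (hz : ‖z‖ < 1) (hw : ‖w‖ < 1) :
    ‖z - w‖ ^ 2 ≤ 2 * ‖(1:ℂ) - inner ℂ z w‖ := by
  have h1 := norm_sub_sq (𝕜 := ℂ) z w
  have h2 : ((1:ℂ) - inner ℂ z w).re ≤ ‖(1:ℂ) - inner ℂ z w‖ := Complex.re_le_norm _
  simp at h1 h2
  nlinarith [norm_nonneg z, norm_nonneg w]

lemma inner_sub_le (z w : E) (hz : ‖z‖ < 1) :
    ‖inner ℂ z (w - z)‖ ≤ (1 - ‖z‖ ^ 2) + ‖(1:ℂ) - inner ℂ z w‖ := by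
  have e : inner ℂ z (w - z) = ((1 - ‖z‖ ^ 2 : ℝ) : ℂ) - ((1:ℂ) - inner ℂ z w) := by
    rw [inner_sub_right, inner_self_eq_norm_sq_to_K]
    push_cast
    simp
  rw [e]
  refine (norm_sub_le _ _).trans ?_
  rw [Complex.norm_real, Real.norm_of_nonneg (dl_pos hz).le]

lemma Nr.trans {K : ℝ} (hK : 1 ≤ K) {z w u : E} (hz : ‖z‖ < 1) (hw : ‖w‖ < 1) (hu : ‖u‖ < 1)
    (h1 : Nr K z w) (h2 : Nr K w u) : Nr (10 * K ^ 2) z u := by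
  have hdw := dl_pos hw
  have a1 := sub_sq_le z w hz hw
  have a2 := sub_sq_le w u hw hu
  have a3 := inner_sub_le w u hw
  have b1 := h1.2
  have b2 := h2.1
  have c1 := h1.dl_le hz hw
  have c2 := h2.symm.dl_le hu hw
  have e : (1:ℂ) - inner ℂ z u = (1 - inner ℂ z w) - inner ℂ w (u - w) - inner ℂ (z - w) (u - w) := by
    simp only [inner_sub_left, inner_sub_right]
    ring
  have c3 : ‖inner ℂ (z - w) (u - w)‖ ≤ ‖z - w‖ * ‖u - w‖ := norm_inner_le_norm _ _
  rw [norm_sub_rev u w] at c3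
  have c4 : ‖z - w‖ * ‖w - u‖ ≤ 2 * K * (1 - ‖w‖ ^ 2) := by
    nlinarith [sq_nonneg (‖z - w‖ - ‖w - u‖)]
  have c5 : ‖(1:ℂ) - inner ℂ z u‖ ≤ 5 * K * (1 - ‖w‖ ^ 2) := by
    rw [e]
    refine (norm_sub_le _ _).trans ?_
    have := norm_sub_le ((1:ℂ) - inner ℂ z w) (inner ℂ w (u - w))
    nlinarith
  constructor
  · refine c5.trans ?_
    nlinarith
  · refine c5.trans ?_
    nlinarith

/-- The nonisotropic balanced neighbourhood. -/
def Sn (z : E) : Set E := {u | ‖inner ℂ z u‖ < 1 / 8 * (1 - ‖z‖ ^ 2) ∧ ‖u‖ ^ 2 < 1 / 8 * (1 - ‖z‖ ^ 2)}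

lemma Sn_bal (z : E) (c : ℂ) (hc : ‖c‖ ≤ 1) (u : E) (hu : u ∈ Sn z) : c • u ∈ Sn z := by
  obtain ⟨h1, h2⟩ := hu
  constructor
  · rw [inner_smul_right, norm_mul]
    refine lt_of_le_of_lt ?_ h1
    exact mul_le_of_le_one_left (norm_nonneg _) hc
  · rw [norm_smul]
    refine lt_of_le_of_lt ?_ h2
    gcongr
    exact mul_le_of_le_one_left (norm_nonneg _) hc

lemma Sn_near {z u : E} (hz : ‖z‖ < 1) (hu : u ∈ Sn z) : ‖z + u‖ < 1 ∧ Nr 4 z (z + u) := by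
  obtain ⟨h1, h2⟩ := hu
  have hd := dl_pos hz
  have e1 := norm_add_sq (𝕜 := ℂ) z u
  have e2 : (inner ℂ z u : ℂ).re ≤ ‖inner ℂ z u‖ := Complex.re_le_norm _
  simp only [RCLike.re_eq_complex_re] at e1
  have e3 : 1 / 2 * (1 - ‖z‖ ^ 2) ≤ 1 - ‖z + u‖ ^ 2 := by nlinarith
  have e4 : ‖z + u‖ < 1 := by
    nlinarith [norm_nonneg (z + u)]
  have e5 : (1:ℂ) - inner ℂ z (z + u) = ((1 - ‖z‖ ^ 2 : ℝ) : ℂ) - inner ℂ z u := by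
    rw [inner_add_right, inner_self_eq_norm_sq_to_K]
    push_cast
    simp
    ring
  have e6 : ‖(1:ℂ) - inner ℂ z (z + u)‖ ≤ 9 / 8 * (1 - ‖z‖ ^ 2) := by
    rw [e5]
    refine (norm_sub_le _ _).trans ?_
    rw [Complex.norm_real, Real.norm_of_nonneg hd.le]
    linarith
  exact ⟨e4, e6.trans (by linarith), e6.trans (by linarith)⟩

lemma near_Sn {K : ℝ} (hK : 1 ≤ K) {z v : E} (hz : ‖z‖ < 1) (hv : ‖v‖ < 1) (h : Nr K z v) :
    (((17 * K)⁻¹ : ℝ) : ℂ) • (v - z) ∈ Sn z := by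
  have hd := dl_pos hz
  have a1 := sub_sq_le z v hz hv
  have a2 := inner_sub_le z v hz
  have a3 := h.1
  rw [norm_sub_rev] at a1
  have hM : 0 < 17 * K := by linarith
  have hn : ‖(((17 * K)⁻¹ : ℝ) : ℂ)‖ = (17 * K)⁻¹ := by
    rw [Complex.norm_real, Real.norm_of_nonneg (by positivity)]
  constructor
  · rw [inner_smul_right, norm_mul, hn, inv_mul_lt_iff₀ hM]
    nlinarith
  · rw [norm_smul, hn, mul_pow, inv_pow, inv_mul_lt_iff₀ (by positivity)]
    have : 17 * K ≤ (17 * K)^2 := by nlinarith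
    nlinarith

lemma Sn_isOpen (z : E) : IsOpen (Sn z) := by
  apply IsOpen.and
  · exact isOpen_lt (by fun_prop) (by fun_prop)
  · exact isOpen_lt (by fun_prop) (by fun_prop)

lemma Sn_zero {z : E} (hz : ‖z‖ < 1) : (0 : E) ∈ Sn z := by
  have hd := dl_pos hz
  constructor <;> simp <;> simpa using hd

lemma Sn_sub (z : E) : Sn z ⊆ Metric.ball 0 1 := by
  intro u hu
  have := hu.2
  simp only [Metric.mem_ball, dist_zero_right]
  nlinarith [norm_nonneg u, norm_nonneg z]

lemma dens_compare {K : ℝ} (hK : 1 ≤ K) (α c : ℝ) (hc : 0 ≤ c) {z w : E} (hz : ‖z‖ < 1)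
    (hw : ‖w‖ < 1) (h : Nr K z w) :
    ENNReal.ofReal (c * (1 - ‖z‖ ^ 2) ^ α) ≤
      ENNReal.ofReal ((2 * K) ^ |α|) * ENNReal.ofReal (c * (1 - ‖w‖ ^ 2) ^ α) := by
  have hdz := dl_pos hz
  have hdw := dl_pos hw
  have h1 := h.dl_le hz hw
  have h2 := h.symm.dl_le hw hz
  rw [← ENNReal.ofReal_mul (by positivity)]
  apply ENNReal.ofReal_le_ofReal
  have : (1 - ‖z‖ ^ 2) ^ α ≤ (2 * K) ^ |α| * (1 - ‖w‖ ^ 2) ^ α := by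
    rcases le_or_gt 0 α with ha | ha
    · rw [abs_of_nonneg ha, ← Real.mul_rpow (by linarith) hdw.le]
      exact Real.rpow_le_rpow hdz.le h2 ha
    · rw [abs_of_neg ha]
      have h3 : (2 * K * (1 - ‖z‖ ^ 2)) ^ α ≤ (1 - ‖w‖ ^ 2) ^ α :=
        Real.rpow_le_rpow_of_nonpos hdw h1 ha.le
      rw [Real.mul_rpow (by linarith) hdz.le] at h3
      have h4 : 0 < (2 * K) ^ (-α) := Real.rpow_pos_of_pos (by linarith) _
      have h5 : (2 * K) ^ (-α) * (2 * K) ^ α = 1 := by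
        rw [← Real.rpow_add (by linarith)]; simp
      calc (1 - ‖z‖ ^ 2) ^ α = (2 * K) ^ (-α) * ((2 * K) ^ α * (1 - ‖z‖ ^ 2) ^ α) := by
            rw [← mul_assoc, h5, one_mul]
        _ ≤ _ := by gcongr
  calc c * (1 - ‖z‖ ^ 2) ^ α ≤ c * ((2 * K) ^ |α| * (1 - ‖w‖ ^ 2) ^ α) := by gcongr
    _ = _ := by ring

end geom

section meas
variable {E : Type*} [NormedAddCommGroup E] [InnerProductSpace ℂ E] [FiniteDimensional ℂ E]
    [MeasurableSpace E] [BorelSpace E] (μ : Measure E) [μ.IsAddHaarMeasure]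

lemma near_meas (K : ℝ) (hK : 1 ≤ K) : ∃ C : ℝ≥0∞, C ≠ ⊤ ∧ ∀ z : E, ‖z‖ < 1 →
    μ {v | ‖v‖ < 1 ∧ Nr K z v} ≤ C * μ (Sn z) := by
  have : FiniteDimensional ℝ E := FiniteDimensional.complexToReal E
  refine ⟨ENNReal.ofReal |(17 * K) ^ Module.finrank ℝ E|, ENNReal.ofReal_ne_top, fun z hz => ?_⟩
  rw [← Measure.addHaar_smul, ← measure_preimage_add μ z ({v | ‖v‖ < 1 ∧ Nr K z v})]
  apply measure_mono
  intro u hu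
  have h := near_Sn hK hz hu.1 hu.2
  rw [add_sub_cancel_left] at h
  refine ⟨_, h, ?_⟩
  have hM : 17 * K ≠ 0 := by linarith
  change (17 * K) • (((17 * K)⁻¹ : ℝ) : ℂ) • u = u
  rw [Complex.coe_smul, smul_smul, mul_inv_cancel₀ hM, one_smul]

lemma Sn_compare (K : ℝ) (hK : 4 ≤ K) : ∃ C : ℝ≥0∞, C ≠ ⊤ ∧ ∀ z w : E, ‖z‖ < 1 → ‖w‖ < 1 →
    Nr K z w → μ (Sn z) ≤ C * μ (Sn w) := by
  obtain ⟨C, hC, h⟩ := near_meas μ (10 * K ^ 2) (by nlinarith)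
  refine ⟨C, hC, fun z w hz hw hN => le_trans ?_ (h w hw)⟩
  rw [← measure_preimage_add μ z ({v | ‖v‖ < 1 ∧ Nr (10 * K ^ 2) w v})]
  apply measure_mono
  intro u hu
  obtain ⟨h1, h2⟩ := Sn_near hz hu
  exact ⟨h1, hN.symm.trans (by linarith) hw hz h1 (h2.mono hz h1 hK)⟩


lemma main_gen (K : ℝ) (hK : 4 ≤ K) (α c p : ℝ) (hc : 0 ≤ c) (hp : 0 < p) :
    ∃ C : ℝ≥0∞, C ≠ ⊤ ∧ ∀ f : E → ℂ, DifferentiableOn ℂ f (Metric.ball 0 1) → ∀ T : E → ℝ≥0∞,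
      (∀ z, ‖z‖ < 1 → ∀ X : ℝ≥0∞, (∀ w, ‖w‖ < 1 → Nr K z w → ENNReal.ofReal (‖f w‖ ^ p) ≤ X) →
        T z ≤ X) →
      ∫⁻ z, T z ∂((μ.restrict (Metric.ball 0 1)).withDensity
        (fun z => ENNReal.ofReal (c * (1 - ‖z‖ ^ 2) ^ α))) ≤
      C * ∫⁻ z, ENNReal.ofReal (‖f z‖ ^ p) ∂((μ.restrict (Metric.ball 0 1)).withDensity
        (fun z => ENNReal.ofReal (c * (1 - ‖z‖ ^ 2) ^ α))) := by
  have : ProperSpace E := FiniteDimensional.proper ℂ E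
  set K1 := 10 * K ^ 2 with hK1
  have hK1' : 4 ≤ K1 := by nlinarith
  obtain ⟨C1, hC1, h1⟩ := Sn_compare μ K hK
  obtain ⟨C2, hC2, h2⟩ := Sn_compare μ K1 hK1'
  obtain ⟨C3, hC3, h3⟩ := near_meas μ K1 (by linarith)
  set C4 := ENNReal.ofReal ((2 * K1) ^ |α|) with hC4
  refine ⟨C1 * (C4 * C2 * C3), by finiteness, fun f hf T hT => ?_⟩
  set ω : E → ℝ≥0∞ := fun z => ENNReal.ofReal (c * (1 - ‖z‖ ^ 2) ^ α) with hω
  have hωm : Measurable ω := by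
    apply ENNReal.measurable_ofReal.comp
    apply Measurable.const_mul
    apply Measurable.pow_const
    fun_prop
  set B : Set E := Metric.ball 0 1 with hB
  have hBm : MeasurableSet B := measurableSet_ball
  have memB : ∀ z, z ∈ B ↔ ‖z‖ < 1 := fun z => by simp [hB]
  let G : E → ℝ≥0∞ := B.indicator fun z => ENNReal.ofReal (‖f z‖ ^ p)
  have hGm : Measurable G := by
    have hco : ContinuousOn (fun z => ENNReal.ofReal (‖f z‖ ^ p)) B := by
      apply ENNReal.continuous_ofReal.comp_continuousOn
      apply ContinuousOn.rpow_const hf.continuousOn.norm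
      intro x hx; right; exact hp.le
    have := hco.measurable_piecewise (g := fun _ => 0) continuousOn_const hBm
    convert this using 1
    ext z
    simp [G, Set.indicator, Set.piecewise]
  have hGB : ∀ z ∈ B, G z = ENNReal.ofReal (‖f z‖ ^ p) := fun z hz => Set.indicator_of_mem hz _
  let V : E → ℝ≥0∞ := fun z => μ (Sn z)
  have hVm : Measurable V := by
    have hs : MeasurableSet {q : E × E | q.2 ∈ Sn q.1} := by
      apply MeasurableSet.inter
      · exact (isOpen_lt (f := fun q : E × E => ‖inner ℂ q.1 q.2‖)
          (g := fun q : E × E => 1 / 8 * (1 - ‖q.1‖ ^ 2)) (by fun_prop) (by fun_prop)).measurableSet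
      · exact (isOpen_lt (f := fun q : E × E => ‖q.2‖ ^ 2)
          (g := fun q : E × E => 1 / 8 * (1 - ‖q.1‖ ^ 2)) (by fun_prop) (by fun_prop)).measurableSet
    exact measurable_measure_prodMk_left hs
  have hV0 : ∀ z, ‖z‖ < 1 → V z ≠ 0 := fun z hz =>
    ((Sn_isOpen z).measure_pos μ ⟨0, Sn_zero hz⟩).ne'
  have hVt : ∀ z, V z ≠ ⊤ := fun z =>
    ((measure_mono (Sn_sub z)).trans_lt measure_ball_lt_top).ne
  let R : Set (E × E) := {q | ‖q.2‖ < 1 ∧ Nr K1 q.1 q.2}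
  have hRm : MeasurableSet R := by
    apply MeasurableSet.inter
    · exact (isOpen_lt (f := fun q : E × E => ‖q.2‖)
          (g := fun q : E × E => 1) (by fun_prop) (by fun_prop)).measurableSet
    · apply MeasurableSet.inter
      · exact (isClosed_le (f := fun q : E × E => ‖1 - inner ℂ q.1 q.2‖)
          (g := fun q : E × E => K1 * (1 - ‖q.1‖ ^ 2)) (by fun_prop) (by fun_prop)).measurableSet
      · exact (isClosed_le (f := fun q : E × E => ‖1 - inner ℂ q.1 q.2‖)
          (g := fun q : E × E => K1 * (1 - ‖q.2‖ ^ 2)) (by fun_prop) (by fun_prop)).measurableSet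
  let k : E → E → ℝ≥0∞ := fun z v => R.indicator 1 (z, v)
  have hkm : Measurable (Function.uncurry k) := measurable_one.indicator hRm
  have hkm1 : ∀ z, Measurable (k z) := fun z => hkm.comp measurable_prodMk_left
  let I : E → ℝ≥0∞ := fun z => ∫⁻ v, k z v * G v ∂μ
  have hIm : Measurable I :=
    Measurable.lintegral_prod_right' (f := fun q : E × E => Function.uncurry k q * G q.2)
      (hkm.mul (hGm.comp measurable_snd))
  -- pointwise bound
  have hpt : ∀ z ∈ B, T z ≤ C1 * ((V z)⁻¹ * I z) := by
    intro z hz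
    have hz' := (memB z).1 hz
    apply hT z hz'
    intro w hw hN
    have hsm := aux_submean μ f B Metric.isOpen_ball hf p hp G hGm hGB w (Sn w)
      (Sn_isOpen w).measurableSet (Sn_bal w) (fun u hu => (memB _).2 (Sn_near hw hu).1)
    have hI : ∫⁻ u in Sn w, G (w + u) ∂μ ≤ I z := by
      have e : I z = ∫⁻ u, k z (w + u) * G (w + u) ∂μ :=
        (lintegral_add_left_eq_self (fun v => k z v * G v) w).symm
      rw [e, ← lintegral_indicator (Sn_isOpen w).measurableSet]
      apply lintegral_mono
      intro u
      by_cases hu : u ∈ Sn w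
      · obtain ⟨n1, n2⟩ := Sn_near hw hu
        have : k z (w + u) = 1 := by
          have hr : (z, w + u) ∈ R :=
            ⟨n1, hN.trans (by linarith) hz' hw n1 (n2.mono hw n1 hK)⟩
          simp [k, hr]
        simp only [Set.indicator_of_mem hu, this, one_mul, le_refl]
      · simp [Set.indicator_of_notMem hu]
    have hcmp := h1 z w hz' hw hN
    calc ENNReal.ofReal (‖f w‖ ^ p)
        = ENNReal.ofReal (‖f w‖ ^ p) * ((V z)⁻¹ * V z) := by
          rw [ENNReal.inv_mul_cancel (hV0 z hz') (hVt z), mul_one]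
      _ ≤ ENNReal.ofReal (‖f w‖ ^ p) * ((V z)⁻¹ * (C1 * μ (Sn w))) := by gcongr
      _ = C1 * ((V z)⁻¹ * (ENNReal.ofReal (‖f w‖ ^ p) * μ (Sn w))) := by ring
      _ ≤ C1 * ((V z)⁻¹ * I z) := by
          gcongr
          exact hsm.trans hI
  have hinner : ∀ v, ‖v‖ < 1 → ∫⁻ z in B, ω z * ((V z)⁻¹ * k z v) ∂μ ≤ C4 * C2 * C3 * ω v := by
    intro v hv
    have hset : MeasurableSet {z : E | ‖z‖ < 1 ∧ Nr K1 v z} :=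
      hRm.preimage measurable_prodMk_left
    calc ∫⁻ z in B, ω z * ((V z)⁻¹ * k z v) ∂μ
        ≤ ∫⁻ z in B, ({z : E | ‖z‖ < 1 ∧ Nr K1 v z}).indicator
            (fun _ => (C4 * ω v) * (C2 * (V v)⁻¹)) z ∂μ := by
          apply setLIntegral_mono' hBm
          intro z hz
          have hz' := (memB z).1 hz
          by_cases hN : Nr K1 z v
          · rw [Set.indicator_of_mem (by exact ⟨hz', hN.symm⟩)]
            have hk : k z v = 1 := by
              have hr : (z, v) ∈ R := ⟨hv, hN⟩
              simp [k, hr]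
            rw [hk, mul_one]
            gcongr
            · exact dens_compare (by linarith) α c hc hz' hv hN
            · have hcc := h2 v z hv hz' hN.symm
              calc (V z)⁻¹ = (V z)⁻¹ * (V v * (V v)⁻¹) := by
                    rw [ENNReal.mul_inv_cancel (hV0 v hv) (hVt v), mul_one]
                _ ≤ (V z)⁻¹ * ((C2 * V z) * (V v)⁻¹) := by gcongr
                _ = C2 * (V v)⁻¹ * ((V z)⁻¹ * V z) := by ring
                _ = C2 * (V v)⁻¹ := by
                    rw [ENNReal.inv_mul_cancel (hV0 z hz') (hVt z), mul_one]
          · have hk : k z v = 0 := by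
              have hr : (z, v) ∉ R := fun h => hN h.2
              simp [k, hr]
            simp [hk]
      _ ≤ ∫⁻ z, ({z : E | ‖z‖ < 1 ∧ Nr K1 v z}).indicator
            (fun _ => (C4 * ω v) * (C2 * (V v)⁻¹)) z ∂μ := setLIntegral_le_lintegral _ _
      _ = (C4 * ω v) * (C2 * (V v)⁻¹) * μ {z : E | ‖z‖ < 1 ∧ Nr K1 v z} := by
          rw [lintegral_indicator hset, setLIntegral_const]
      _ ≤ (C4 * ω v) * (C2 * (V v)⁻¹) * (C3 * V v) := by
          gcongr
          exact h3 v hv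
      _ = C4 * C2 * C3 * ω v * ((V v)⁻¹ * V v) := by ring
      _ = C4 * C2 * C3 * ω v := by
          rw [ENNReal.inv_mul_cancel (hV0 v hv) (hVt v), mul_one]
  set ν := (μ.restrict B).withDensity ω with hν
  have hae : ∀ᵐ z ∂ν, z ∈ B := by
    have : ∀ᵐ z ∂(μ.restrict B), z ∈ B := ae_restrict_mem hBm
    exact (withDensity_absolutelyContinuous _ _).ae_le this
  have m1 : Measurable (fun z => C1 * ((V z)⁻¹ * I z)) := (hVm.inv.mul hIm).const_mul C1
  have m2 : Measurable (fun z => ω z * ((V z)⁻¹ * I z)) := hωm.mul (hVm.inv.mul hIm)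
  have m3 : ∀ z, Measurable (fun v => k z v * G v) := fun z => (hkm1 z).mul hGm
  have m4 : Measurable (fun z => ω z * G z) := hωm.mul hGm
  calc ∫⁻ z, T z ∂ν ≤ ∫⁻ z, C1 * ((V z)⁻¹ * I z) ∂ν := by
        apply lintegral_mono_ae
        filter_upwards [hae] with z hz using hpt z hz
    _ = ∫⁻ z in B, ω z * (C1 * ((V z)⁻¹ * I z)) ∂μ := by
        rw [hν, lintegral_withDensity_eq_lintegral_mul _ hωm m1]
        rfl
    _ = C1 * ∫⁻ z in B, ω z * ((V z)⁻¹ * I z) ∂μ := by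
        rw [← lintegral_const_mul _ m2]
        apply lintegral_congr; intro z; ring
    _ = C1 * ∫⁻ z in B, ∫⁻ v, ω z * ((V z)⁻¹ * k z v) * G v ∂μ ∂μ := by
        congr 1
        apply lintegral_congr
        intro z
        simp only [I]
        rw [← mul_assoc, ← lintegral_const_mul _ (m3 z)]
        apply lintegral_congr; intro v; ring
    _ = C1 * ∫⁻ v, ∫⁻ z in B, ω z * ((V z)⁻¹ * k z v) * G v ∂μ ∂μ := by
        congr 1
        apply lintegral_lintegral_swap
        apply Measurable.aemeasurable
        exact ((hωm.comp measurable_fst).mul ((hVm.inv.comp measurable_fst).mul hkm)).mul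
          (hGm.comp measurable_snd)
    _ = C1 * ∫⁻ v, (∫⁻ z in B, ω z * ((V z)⁻¹ * k z v) ∂μ) * G v ∂μ := by
        congr 1
        apply lintegral_congr
        intro v
        rw [lintegral_mul_const]
        exact hωm.mul (hVm.inv.mul (hkm.comp measurable_prodMk_right))
    _ ≤ C1 * ∫⁻ v, B.indicator (fun v => (C4 * C2 * C3) * (ω v * ENNReal.ofReal (‖f v‖ ^ p))) v ∂μ := by
        gcongr with v
        by_cases hv : v ∈ B
        · rw [Set.indicator_of_mem hv, hGB v hv, ← mul_assoc]
          gcongr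
          exact hinner v ((memB v).1 hv)
        · simp [G, Set.indicator_of_notMem hv]
    _ = C1 * (C4 * C2 * C3) * ∫⁻ z, ENNReal.ofReal (‖f z‖ ^ p) ∂ν := by
        have hGν : ∫⁻ z, ENNReal.ofReal (‖f z‖ ^ p) ∂ν = ∫⁻ z, G z ∂ν := by
          apply lintegral_congr_ae
          filter_upwards [hae] with z hz using (hGB z hz).symm
        rw [hGν, hν, lintegral_withDensity_eq_lintegral_mul _ hωm hGm,
          lintegral_indicator hBm, mul_assoc C1]
        simp only [Pi.mul_apply]
        rw [← lintegral_const_mul _ m4]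
        congr 1
        apply setLIntegral_congr_fun hBm
        intro z hz
        simp only [hGB z hz]

end meas

lemma herm_eq {n : ℕ} (z w : En n) : herm w z = inner ℂ z w := by
  simp only [herm, PiLp.inner_apply]
  apply Finset.sum_congr rfl
  intro j _
  simp

lemma prj_eq {n : ℕ} (z w : En n) : ∃ b : ℂ, prj z w = b • z ∧ inner ℂ z w = b * ((‖z‖ ^ 2 : ℝ) : ℂ) := by
  by_cases hz : z = 0
  · exact ⟨0, by simp [prj, hz], by simp [hz]⟩
  · refine ⟨herm w z / herm z z, by simp [prj, hz], ?_⟩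
    have h0 : (inner ℂ z z : ℂ) ≠ 0 := inner_self_ne_zero.2 hz
    rw [herm_eq, herm_eq]
    have : (((‖z‖ ^ 2 : ℝ)) : ℂ) = inner ℂ z z := by
      rw [inner_self_eq_norm_sq_to_K]; simp
    rw [this, div_mul_cancel₀ _ h0]

lemma mobius_id {n : ℕ} (z w : En n) (hz : ‖z‖ < 1) (hw : ‖w‖ < 1) :
    ‖mobius z w‖ ^ 2 * ‖(1:ℂ) - inner ℂ z w‖ ^ 2 =
      ‖(1:ℂ) - inner ℂ z w‖ ^ 2 - (1 - ‖z‖ ^ 2) * (1 - ‖w‖ ^ 2) := by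
  obtain ⟨b, hb, ha⟩ := prj_eq z w
  have hdz := dl_pos hz
  have hdw := dl_pos hw
  have hpos : 0 < ‖(1:ℂ) - inner ℂ z w‖ := by
    have := dl_le z w hz hw
    linarith
  unfold mobius
  rw [hb, herm_eq, norm_smul, norm_div, norm_one, mul_pow, div_pow, one_pow, mul_right_comm,
    one_div, inv_mul_cancel₀ (by positivity), one_mul]
  set s := Real.sqrt (1 - ‖z‖ ^ 2) with hs
  have hs2 : s ^ 2 = 1 - ‖z‖ ^ 2 := Real.sq_sqrt hdz.le
  have hv : z - b • z - (s : ℂ) • (w - b • z) = (1 - b + s * b) • z - (s : ℂ) • w := by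
    module
  rw [hv, norm_sub_sq (𝕜 := ℂ), norm_smul, norm_smul, inner_smul_left, inner_smul_right, ha,
    mul_pow, mul_pow]
  generalize ‖z‖ = r at *
  generalize ‖w‖ = t at *
  clear_value s
  simp only [← Complex.normSq_eq_norm_sq, Complex.normSq_apply]
  simp
  have h4 : r ^ 2 = 1 - s ^ 2 := by linarith
  simp only [← Complex.ofReal_pow, Complex.ofReal_re, Complex.ofReal_im, h4]
  ring

lemma Dball_near {n : ℕ} {γ : ℝ} {z w : En n} (hz : ‖z‖ < 1) (h : w ∈ Dball z γ) :
    ‖w‖ < 1 ∧ Nr (2 * Real.exp (2 * γ)) z w := by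
  obtain ⟨hw, hb⟩ := h
  have hw : ‖w‖ < 1 := by simpa [uball] using hw
  refine ⟨hw, ?_⟩
  have hid := mobius_id z w hz hw
  have hdz := dl_pos hz
  have hdw := dl_pos hw
  have l1 := dl_le z w hz hw
  have l2 := dl_le w z hw hz
  rw [one_sub_symm w z] at l2
  unfold bmet at hb
  unfold Nr
  have hx0 := norm_nonneg (mobius z w)
  generalize ‖mobius z w‖ = x at *
  generalize ‖(1:ℂ) - inner ℂ z w‖ = A at *
  generalize 1 - ‖z‖ ^ 2 = dz at *
  generalize 1 - ‖w‖ ^ 2 = dw at *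
  have hA : 0 < A := by linarith
  have hx2 : (1 - x ^ 2) * A ^ 2 = dz * dw := by linarith
  have hx1 : x < 1 := by
    by_contra hc
    push Not at hc
    have : 0 < dz * dw := by positivity
    have h1 : 1 ≤ x ^ 2 := one_le_pow₀ hc
    nlinarith [sq_nonneg A]
  set Q := Real.exp (2 * γ) with hQ
  have hQ0 : 0 < Q := Real.exp_pos _
  have hq : (1 + x) / (1 - x) < Q := by
    rw [hQ, ← Real.log_lt_iff_lt_exp (div_pos (by linarith) (by linarith))]
    linarith
  have hq2 : 1 ≤ Q * (1 - x ^ 2) := by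
    rw [div_lt_iff₀ (by linarith)] at hq
    nlinarith
  have hA2 : A ^ 2 ≤ Q * (dz * dw) := by
    rw [← hx2]
    nlinarith [sq_nonneg A]
  constructor
  · have : A * A ≤ (2 * Q * dz) * A := by
      have : Q * dz * dw ≤ Q * dz * (2 * A) := by gcongr
      nlinarith
    exact le_of_mul_le_mul_right this hA
  · have : A * A ≤ (2 * Q * dw) * A := by
      have : Q * dw * dz ≤ Q * dw * (2 * A) := by gcongr
      nlinarith
    exact le_of_mul_le_mul_right this hA

lemma Dball_self {n : ℕ} {γ : ℝ} (hγ : 0 < γ) {z : En n} (hz : ‖z‖ < 1) : z ∈ Dball z γ := by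
  refine ⟨by simpa [uball] using hz, ?_⟩
  have hp : prj z z = z := by
    by_cases h : z = 0
    · simp [prj, h]
    · have h0 : (inner ℂ z z : ℂ) ≠ 0 := inner_self_ne_zero.2 h
      simp only [prj, h, if_false, herm_eq]
      rw [div_self h0, one_smul]
  have : mobius z z = 0 := by simp [mobius, hp]
  simp [bmet, this, hγ]

instance vol_haar (n : ℕ) : (vol n).IsAddHaarMeasure := by
  unfold vol; infer_instance

/-- Maximal function characterization of Bergman spaces:
`f ∈ A^p_α` iff `M_γ f ∈ L^p(dv_α)`, with `‖f‖_{p,α} ≈ ‖M_γ f‖_{L^p(dv_α)}`. -/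
theorem stmt5 (n : ℕ) (hn : 1 ≤ n) (γ α p : ℝ) (hγ : 0 < γ) (hα : -1 < α) (hp : 0 < p) :
    ∃ C : ℝ≥0∞, 0 < C ∧ C < ⊤ ∧
      ∀ f : En n → ℂ, DifferentiableOn ℂ f (uball n) →
        ((apnorm n p α f < ⊤ ↔
            (∫⁻ z, (maxF γ (fun w => ‖f w‖) z) ^ p ∂measA n α) < ⊤) ∧
         C⁻¹ * (∫⁻ z, (maxF γ (fun w => ‖f w‖) z) ^ p ∂measA n α) ^ (1 / p) ≤
            apnorm n p α f ∧
         apnorm n p α f ≤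
            C * (∫⁻ z, (maxF γ (fun w => ‖f w‖) z) ^ p ∂measA n α) ^ (1 / p)) := by
  have hc : 0 ≤ cnorm n α := by
    unfold cnorm
    rw [if_pos hα]
    have h1 : 0 < Real.Gamma (n + α + 1) := Real.Gamma_pos_of_pos (by
      have : (0:ℝ) ≤ n := Nat.cast_nonneg n
      linarith)
    have h2 : 0 < Real.Gamma (α + 1) := Real.Gamma_pos_of_pos (by linarith)
    positivity
  obtain ⟨C, hC, hmain⟩ := main_gen (vol n) (max (2 * Real.exp (2 * γ)) 4) (le_max_right _ _)
    α (cnorm n α) p hc hp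
  have hq : 0 < 1 / p := by positivity
  have hC1 : max C 1 ≠ ⊤ := by simp [hC]
  have hC0 : max C 1 ≠ 0 := by
    have : (1:ℝ≥0∞) ≤ max C 1 := le_max_right _ _
    exact (lt_of_lt_of_le one_pos this).ne'
  have hD1 : (1:ℝ≥0∞) ≤ (max C 1) ^ (1 / p) := ENNReal.one_le_rpow (le_max_right _ _) hq
  have hDt : (max C 1) ^ (1 / p) ≠ ⊤ := ENNReal.rpow_ne_top_of_nonneg hq.le hC1
  have hD0 : (max C 1) ^ (1 / p) ≠ 0 := (lt_of_lt_of_le one_pos hD1).ne'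
  refine ⟨(max C 1) ^ (1 / p), pos_iff_ne_zero.2 hD0, hDt.lt_top, fun f hf => ?_⟩
  have hle : ∀ z, z ∈ uball n → ENNReal.ofReal (‖f z‖ ^ p) ≤ (maxF γ (fun w => ‖f w‖) z) ^ p := by
    intro z hz
    rw [← ENNReal.ofReal_rpow_of_nonneg (norm_nonneg _) hp.le]
    apply ENNReal.rpow_le_rpow _ hp.le
    exact le_iSup₂ (f := fun w (_ : w ∈ Dball z γ) => ENNReal.ofReal ‖f w‖) z
      (Dball_self hγ (by simpa [uball] using hz))
  have hae : ∀ᵐ z ∂(measA n α), z ∈ uball n := by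
    have : ∀ᵐ z ∂((vol n).restrict (uball n)), z ∈ uball n := ae_restrict_mem measurableSet_ball
    exact (withDensity_absolutelyContinuous _ _).ae_le this
  have hA : ∫⁻ z, ENNReal.ofReal (‖f z‖ ^ p) ∂measA n α ≤
      ∫⁻ z, (maxF γ (fun w => ‖f w‖) z) ^ p ∂measA n α := by
    apply lintegral_mono_ae
    filter_upwards [hae] with z hz using hle z hz
  have hJ : ∫⁻ z, (maxF γ (fun w => ‖f w‖) z) ^ p ∂measA n α ≤
      C * ∫⁻ z, ENNReal.ofReal (‖f z‖ ^ p) ∂measA n α := by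
    refine hmain f hf (fun z => (maxF γ (fun w => ‖f w‖) z) ^ p) ?_
    intro z hz X hX
    have : maxF γ (fun w => ‖f w‖) z ≤ X ^ (1 / p) := by
      refine iSup₂_le fun w hw => ?_
      obtain ⟨h1, h2⟩ := Dball_near hz hw
      have := hX w h1 (h2.mono hz h1 (le_max_left _ _))
      rw [← ENNReal.ofReal_rpow_of_nonneg (norm_nonneg _) hp.le] at this
      rw [one_div, ENNReal.le_rpow_inv_iff hp]
      exact this
    rw [one_div, ENNReal.le_rpow_inv_iff hp] at this
    exact this
  unfold apnorm
  generalize ∫⁻ z, ENNReal.ofReal (‖f z‖ ^ p) ∂measA n α = A at *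
  generalize ∫⁻ z, (maxF γ (fun w => ‖f w‖) z) ^ p ∂measA n α = J at *
  have hJ' : J ≤ max C 1 * A := hJ.trans (by gcongr; exact le_max_left _ _)
  refine ⟨?_, ?_, ?_⟩
  · rw [ENNReal.rpow_lt_top_iff_of_pos hq]
    exact ⟨fun h => hJ.trans_lt (ENNReal.mul_lt_top hC.lt_top h), fun h => hA.trans_lt h⟩
  · rw [ENNReal.inv_mul_le_iff hD0 hDt, ← ENNReal.mul_rpow_of_nonneg _ _ hq.le]
    exact ENNReal.rpow_le_rpow hJ' hq.le
  · calc A ^ (1 / p) ≤ J ^ (1 / p) := ENNReal.rpow_le_rpow hA hq.le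
      _ = 1 * J ^ (1 / p) := (one_mul _).symm
      _ ≤ _ := by gcongr
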